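/- Fix q ∈ ℝ with q ≠ 0 and q² ≠ 1. For real coefficients α₁,…,α₆, β₁, β₂, β₃, the quadratic combination W = α₁L̂² + α₂L̂M̂₁ + α₃L̂M̂₂ + α₄M̂₁² + α₅M̂₁M̂₂ + α₆M̂₂² + β₁M̂₁R̂₂ + β₂M̂₂R̂₁ + β₃M̂₂R̂₂ of the S-Heun operators on the q-linear grid equals, pointwise at all z ≠ 0, the operator 𝒜₁T̂₊² + 𝒜₀I + 𝒜₂T̂₋² (where T̂₊², T̂₋² rescale the argument by q^{±2}), with 𝒜₁(z) = [qα₁ + (q²α₃ − qα₂)z + (q²α₆ − qα₅ + α₄)z² + (q³β₃ − q²β₁ − q²β₂)z³] / (z²(1−q²)²), 𝒜₂(z) = [q³α₁ + (q²α₃ − q³α₂)z + (q²α₆ − q³α₅ + q⁴α₄)z² + (qβ₃ − q²β₁ − q²β₂)z³] / (z²(1−q²)²), and 𝒜₀(z) = β₂z + α₄ − (𝒜₁(z)+𝒜₂(z)). Conversely, every operator 𝒜₁T̂₊² + 𝒜₀I + 𝒜₂T̂₋² with 𝒜₁(z) = π₃(z)/z², 𝒜₂(z) = (q²π₃(z)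 + zπ₂(z))/z², and 𝒜₀ + 𝒜₁ + 𝒜₂ = π₁(z), where π₃, π₂, π₁ are polynomials of degrees at most 3, 2, 1 respectively, arises from such a quadratic combination. Hence the generic Heun–Big q-Jacobi operator (with base q²) is exactly the most general quadratic combination of the q-grid S-Heun operators that does not raise the degree of polynomials by more than one. -/

import Mathlib

open Polynomial

/-- Lowering S-Heun operator `L̂ = (q−q⁻¹)⁻¹ z⁻¹(T̂₊−T̂₋)` on the q-linear grid. -/
noncomputable def hL (q : ℝ) (f : ℝ → ℝ) : ℝ → ℝ :=
  fun z => (q - q⁻¹)⁻¹ * z⁻¹ * (f (q*z) - f (q⁻¹*z))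
/-- Stabilizing S-Heun operator `M̂₁ = (q−q⁻¹)⁻¹(−q⁻¹T̂₊+qT̂₋)`. -/
noncomputable def hM1 (q : ℝ) (f : ℝ → ℝ) : ℝ → ℝ :=
  fun z => (q - q⁻¹)⁻¹ * (-q⁻¹ * f (q*z) + q * f (q⁻¹*z))
/-- Stabilizing S-Heun operator `M̂₂ = (q−q⁻¹)⁻¹(T̂₊−T̂₋)`. -/
noncomputable def hM2 (q : ℝ) (f : ℝ → ℝ) : ℝ → ℝ :=
  fun z => (q - q⁻¹)⁻¹ * (f (q*z) - f (q⁻¹*z))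
/-- Raising S-Heun operator `R̂₁ = (q−q⁻¹)⁻¹ z(−q⁻¹T̂₊+qT̂₋)`. -/
noncomputable def hR1 (q : ℝ) (f : ℝ → ℝ) : ℝ → ℝ :=
  fun z => (q - q⁻¹)⁻¹ * z * (-q⁻¹ * f (q*z) + q * f (q⁻¹*z))
/-- Raising S-Heun operator `R̂₂ = (q−q⁻¹)⁻¹ z(T̂₊−T̂₋)`. -/
noncomputable def hR2 (q : ℝ) (f : ℝ → ℝ) : ℝ → ℝ :=
  fun z => (q - q⁻¹)⁻¹ * z * (f (q*z) - f (q⁻¹*z))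

/-- Coefficient `𝒜₁` of the Heun–Big q-Jacobi operator. -/
noncomputable def bjA1 (q α₁ α₂ α₃ α₄ α₅ α₆ β₁ β₂ β₃ : ℝ) (z : ℝ) : ℝ :=
  (q*α₁ + (q^2*α₃ - q*α₂)*z + (q^2*α₆ - q*α₅ + α₄)*z^2
    + (q^3*β₃ - q^2*β₁ - q^2*β₂)*z^3) / (z^2*(1 - q^2)^2)

/-- Coefficient `𝒜₂` of the Heun–Big q-Jacobi operator. -/
noncomputable def bjA2 (q α₁ α₂ α₃ α₄ α₅ α₆ β₁ β₂ β₃ : ℝ) (z : ℝ) : ℝ :=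
  (q^3*α₁ + (q^2*α₃ - q^3*α₂)*z + (q^2*α₆ - q^3*α₅ + q^4*α₄)*z^2
    + (q*β₃ - q^2*β₁ - q^2*β₂)*z^3) / (z^2*(1 - q^2)^2)

/-- The general quadratic combination
`W = α₁L̂² + α₂L̂M̂₁ + α₃L̂M̂₂ + α₄M̂₁² + α₅M̂₁M̂₂ + α₆M̂₂² + β₁M̂₁R̂₂ + β₂M̂₂R̂₁ + β₃M̂₂R̂₂`. -/
noncomputable def bjW (q α₁ α₂ α₃ α₄ α₅ α₆ β₁ β₂ β₃ : ℝ) (f : ℝ → ℝ) : ℝ → ℝ := fun z =>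
  α₁ * hL q (hL q f) z + α₂ * hL q (hM1 q f) z + α₃ * hL q (hM2 q f) z
  + α₄ * hM1 q (hM1 q f) z + α₅ * hM1 q (hM2 q f) z + α₆ * hM2 q (hM2 q f) z
  + β₁ * hM1 q (hR2 q f) z + β₂ * hM2 q (hR1 q f) z + β₃ * hM2 q (hR2 q f) z

theorem part1 (q : ℝ) (hq : q ≠ 0) (hq2 : q^2 ≠ 1) :
    (∀ α₁ α₂ α₃ α₄ α₅ α₆ β₁ β₂ β₃ : ℝ, ∀ (f : ℝ → ℝ) (z : ℝ), z ≠ 0 →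
      bjW q α₁ α₂ α₃ α₄ α₅ α₆ β₁ β₂ β₃ f z
        = bjA1 q α₁ α₂ α₃ α₄ α₅ α₆ β₁ β₂ β₃ z * f (q^2*z)
          + (β₂*z + α₄
              - (bjA1 q α₁ α₂ α₃ α₄ α₅ α₆ β₁ β₂ β₃ z
                 + bjA2 q α₁ α₂ α₃ α₄ α₅ α₆ β₁ β₂ β₃ z)) * f z
          + bjA2 q α₁ α₂ α₃ α₄ α₅ α₆ β₁ β₂ β₃ z * f ((q^2)⁻¹*z)) := by
  intro α₁ α₂ α₃ α₄ α₅ α₆ β₁ β₂ β₃ f z hz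
  have h1 : q^2 - 1 ≠ 0 := sub_ne_zero.mpr hq2
  have h2 : 1 - q^2 ≠ 0 := sub_ne_zero.mpr (Ne.symm hq2)
  have hc : (q - q⁻¹)⁻¹ = q / (q^2 - 1) := by
    have : q - q⁻¹ = (q^2 - 1) / q := by field_simp
    rw [this, inv_div]
  have e1 : q * (q * z) = q^2 * z := by ring
  have e2 : q⁻¹ * (q * z) = z := by field_simp
  have e3 : q * (q⁻¹ * z) = z := by field_simp
  have e4 : q⁻¹ * (q⁻¹ * z) = (q^2)⁻¹ * z := by field_simp
  simp only [bjW, hL, hM1, hM2, hR1, hR2, bjA1, bjA2, hc, e1, e2, e3, e4]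
  generalize f (q^2 * z) = a
  generalize f z = b
  generalize f ((q^2)⁻¹ * z) = c
  have h3 : (1 - q^2)^2 = (q^2 - 1)^2 := by ring
  rw [h3]
  field_simp
  ring

/-- The generic Heun–Big q-Jacobi operator (with base `q²`) is exactly the most general
quadratic combination of the q-grid S-Heun operators that does not raise the degree of
polynomials by more than one. -/
theorem stmt_16 (q : ℝ) (hq : q ≠ 0) (hq2 : q^2 ≠ 1) :
    (∀ α₁ α₂ α₃ α₄ α₅ α₆ β₁ β₂ β₃ : ℝ, ∀ (f : ℝ → ℝ) (z : ℝ), z ≠ 0 →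
      bjW q α₁ α₂ α₃ α₄ α₅ α₆ β₁ β₂ β₃ f z
        = bjA1 q α₁ α₂ α₃ α₄ α₅ α₆ β₁ β₂ β₃ z * f (q^2*z)
          + (β₂*z + α₄
              - (bjA1 q α₁ α₂ α₃ α₄ α₅ α₆ β₁ β₂ β₃ z
                 + bjA2 q α₁ α₂ α₃ α₄ α₅ α₆ β₁ β₂ β₃ z)) * f z
          + bjA2 q α₁ α₂ α₃ α₄ α₅ α₆ β₁ β₂ β₃ z * f ((q^2)⁻¹*z)) ∧
    (∀ (π₃ π₂ π₁ : ℝ[X]), π₃.degree ≤ (3 : ℕ) → π₂.degree ≤ (2 : ℕ) →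
      π₁.degree ≤ (1 : ℕ) →
      ∃ α₁ α₂ α₃ α₄ α₅ α₆ β₁ β₂ β₃ : ℝ, ∀ (f : ℝ → ℝ) (z : ℝ), z ≠ 0 →
        bjW q α₁ α₂ α₃ α₄ α₅ α₆ β₁ β₂ β₃ f z
          = (π₃.eval z / z^2) * f (q^2*z)
            + (π₁.eval z - π₃.eval z / z^2
                - (q^2*π₃.eval z + z*π₂.eval z) / z^2) * f z
            + ((q^2*π₃.eval z + z*π₂.eval z) / z^2) * f ((q^2)⁻¹*z)) := by
  refine ⟨part1 q hq hq2, ?_⟩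
  intro π₃ π₂ π₁ d3 d2 d1
  have h1 : q^2 - 1 ≠ 0 := sub_ne_zero.mpr hq2
  have n3 : π₃.natDegree < 4 := Nat.lt_succ_of_le (natDegree_le_of_degree_le d3)
  have n2 : π₂.natDegree < 3 := Nat.lt_succ_of_le (natDegree_le_of_degree_le d2)
  have n1 : π₁.natDegree < 2 := Nat.lt_succ_of_le (natDegree_le_of_degree_le d1)
  have v3 := fun z => eval_eq_sum_range' n3 z
  have v2 := fun z => eval_eq_sum_range' n2 z
  have v1 := fun z => eval_eq_sum_range' n1 z
  simp only [Finset.sum_range_succ, Finset.sum_range_zero] at v3 v2 v1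
  simp only [v3, v2, v1]
  generalize π₃.coeff 0 = p0
  generalize π₃.coeff 1 = p1
  generalize π₃.coeff 2 = p2
  generalize π₃.coeff 3 = p3
  generalize π₂.coeff 0 = r0
  generalize π₂.coeff 1 = r1
  generalize π₂.coeff 2 = r2
  generalize π₁.coeff 0 = s0
  generalize π₁.coeff 1 = s1
  obtain ⟨D, hD⟩ : ∃ D, D = (1 - q^2)^2 := ⟨_, rfl⟩
  have hD0 : D ≠ 0 := by
    rw [hD]; exact pow_ne_zero _ (sub_ne_zero.mpr (Ne.symm hq2))
  have sol : ∀ E F : ℝ, ∃ x y : ℝ, q^2*y - q*x = E ∧ q^2*y - q^3*x = F := by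
    intro E F
    refine ⟨(E - F) / (q*(q^2-1)), (E + (E-F)/(q^2-1)) / q^2, ?_, ?_⟩ <;> field_simp <;> ring
  obtain ⟨α₂, α₃, a1, a2⟩ := sol (D*p1) (D*(q^2*p1+r0))
  obtain ⟨α₅, α₆, b1, b2⟩ := sol (D*p2 - s0) (D*(q^2*p2+r1) - q^4*s0)
  have sol2 : ∀ E F : ℝ, ∃ x y : ℝ, q^3*y - q^2*x = E ∧ q*y - q^2*x = F := by
    intro E F
    refine ⟨((E-F)/(q^2-1) - F) / q^2, (E - F) / (q*(q^2-1)), ?_, ?_⟩ <;> field_simp <;> ring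
  obtain ⟨β₁, β₃, c1, c2⟩ := sol2 (D*p3 + q^2*s1) (D*(q^2*p3+r2) + q^2*s1)
  refine ⟨D*p0/q, α₂, α₃, s0, α₅, α₆, β₁, s1, β₃, ?_⟩
  intro f z hz
  rw [part1 q hq hq2 _ _ _ _ _ _ _ _ _ f z hz]
  have hp : q * (D*p0/q) = D*p0 := by field_simp
  have A1 : bjA1 q (D*p0/q) α₂ α₃ s0 α₅ α₆ β₁ s1 β₃ z
      = (0 + p0*z^0 + p1*z^1 + p2*z^2 + p3*z^3) / z^2 := by
    rw [bjA1, ← hD, div_eq_div_iff (by positivity) (by positivity)]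
    linear_combination z^2 * (hp + z * a1 + z^2 * b1 + z^3 * c1)
  have A2 : bjA2 q (D*p0/q) α₂ α₃ s0 α₅ α₆ β₁ s1 β₃ z
      = (q^2*(0 + p0*z^0 + p1*z^1 + p2*z^2 + p3*z^3)
        + z*(0 + r0*z^0 + r1*z^1 + r2*z^2)) / z^2 := by
    rw [bjA2, ← hD, div_eq_div_iff (by positivity) (by positivity)]
    linear_combination z^2 * (q^2 * hp + z * a2 + z^2 * b2 + z^3 * c2)
  rw [A1, A2]
  ring
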